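/- For every object X of T there exists a distinguished triangle X'' → X → X' → S X'' in T with X'' ∈ T_{≤0} and Hom_T(R, X') = 0 for every object R ∈ T_{≤0}. (Truncation-triangle form of Proposition A.1(a), proved by the small object argument.) -/

import Mathlib

/-!
Setting: `T` is a compactly generated triangulated category with suspension
functor `S = ⟦1⟧` admitting arbitrary (small) coproducts, `U ⊆ T_c` is a left
aisle in the full subcategory `T_c` of compact objects, and `T_{≤0}` is the
smallest strictly full subcategory of `T` containing `U` and stable under
arbitrary coproducts and under extensions.
-/

namespace CYPaper

open CategoryTheory CategoryTheory.Limits CategoryTheory.Pretriangulated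

universe v u

variable (T : Type u) [Category.{v} T] [HasZeroObject T] [Preadditive T]
  [HasShift T ℤ] [∀ n : ℤ, (shiftFunctor T n).Additive]
  [Pretriangulated T] [HasCoproducts.{v} T]

instance : HasColimitsOfShape (Discrete ℕ) T :=
  hasColimitsOfShape_of_equivalence (Discrete.equivalence Equiv.ulift.{v, 0})

/-- An object `C` is compact if `Hom(C, −)` (as an additive functor) commutes with
arbitrary (small) coproducts. -/
def IsCompactObj (C : T) : Prop :=
  ∀ I : Type v,
    PreservesColimitsOfShape (Discrete I) (preadditiveCoyoneda.obj (Opposite.op C))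

/-- The class of compact objects, i.e. the full triangulated subcategory `T_c`. -/
def Compacts : Set T := {C | IsCompactObj T C}

/-- `T` is compactly generated: there is a set `G` of compact objects such that an
object `X` is zero whenever `Hom(S^n G, X) = 0` for all `G ∈ G` and all `n : ℤ`. -/
def CompactlyGenerated : Prop :=
  ∃ G : Set T, Small.{v} ↥G ∧ (∀ C ∈ G, IsCompactObj T C) ∧
    ∀ X : T, (∀ C ∈ G, ∀ n : ℤ, ∀ f : C⟦n⟧ ⟶ X, f = 0) → IsZero X

/-- A left aisle in the (strictly) full subcategory of `T` with class of objects `A`: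
a strictly full additive subcategory stable under the suspension and under
extensions, whose inclusion admits a right adjoint (expressed by the existence of
coreflections). -/
structure LeftAisle (A : Set T) where
  carrier : Set T
  subset : carrier ⊆ A
  iso_closed : ∀ {X Y : T}, (X ≅ Y) → Y ∈ A → X ∈ carrier → Y ∈ carrier
  zero_mem : ∀ X : T, IsZero X → X ∈ A → X ∈ carrier
  sum_mem : ∀ {X Y : T}, X ∈ carrier → Y ∈ carrier →
    ∀ c : BinaryCofan X Y, Nonempty (IsColimit c) → c.pt ∈ A → c.pt ∈ carrier
  shift_mem : ∀ X ∈ carrier, X⟦(1 : ℤ)⟧ ∈ carrier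
  ext_mem : ∀ Tr : Triangle T, Tr ∈ (distTriang T) →
    Tr.obj₁ ∈ carrier → Tr.obj₃ ∈ carrier → Tr.obj₂ ∈ A → Tr.obj₂ ∈ carrier
  coreflect : ∀ X ∈ A, ∃ (U₀ : T) (_ : U₀ ∈ carrier) (ε : U₀ ⟶ X),
    ∀ R ∈ carrier, Function.Bijective fun g : R ⟶ U₀ => g ≫ ε

/-- The smallest strictly full subcategory of `T` containing `U` and stable under
arbitrary (small) coproducts and under extensions. -/
inductive aisleGen (U : Set T) : T → Prop
  | of (X : T) (hX : X ∈ U) : aisleGen U X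
  | iso (X Y : T) (e : X ≅ Y) (hX : aisleGen U X) : aisleGen U Y
  | coprod {I : Type v} (Y : I → T) (hY : ∀ i, aisleGen U (Y i)) : aisleGen U (∐ Y)
  | ext (Tr : Triangle T) (hT : Tr ∈ (distTriang T))
      (h₁ : aisleGen U Tr.obj₁) (h₃ : aisleGen U Tr.obj₃) : aisleGen U Tr.obj₂

/-- `T_{≤0}`. -/
def TLe0 (U : Set T) : Set T := {X | aisleGen T U X}

/-- `T_{≤n} := S^{−n} T_{≤0}`. -/
def TLe (U : Set T) (n : ℤ) : Set T := {X | X⟦n⟧ ∈ TLe0 T U}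

/-- `T_{>n} := (T_{≤n})^⊥`. -/
def TGt (U : Set T) (n : ℤ) : Set T := {Y | ∀ Z ∈ TLe T U n, ∀ f : Z ⟶ Y, f = 0}

/-- A truncation triangle `τ_{≤n} X → X → τ_{>n} X → S (τ_{≤n} X)` of `X` with
respect to the left aisle `T_{≤n}` on `T`. -/
structure TruncTriangle (U : Set T) (n : ℤ) (X : T) where
  low : T
  high : T
  ι : low ⟶ X
  π : X ⟶ high
  δ : high ⟶ low⟦(1 : ℤ)⟧
  low_mem : low ∈ TLe T U n
  high_mem : high ∈ TGt T U n
  dist : Triangle.mk ι π δ ∈ (distTriang T)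

/-- Data computing `H^n X = τ_{≥n} τ_{≤n} X = τ_{>n−1} τ_{≤n} X`: a truncation
triangle `t` of `X` at level `n` together with a truncation triangle `s` of
`τ_{≤n} X = t.low` at level `n − 1`; then `H^n X = s.high`. -/
structure HomologyData (U : Set T) (n : ℤ) (X : T) where
  t : TruncTriangle T U n X
  s : TruncTriangle T U (n - 1) t.low

/-- The morphism `H^n f : H^n X ⟶ H^n Y` induced by `f : X ⟶ Y` on the homology
objects, encoded by its defining compatibilities. -/
structure HomologyMapData (U : Set T) (n : ℤ) {X Y : T} (f : X ⟶ Y)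
    (dX : HomologyData T U n X) (dY : HomologyData T U n Y) where
  g : dX.t.low ⟶ dY.t.low
  hg : g ≫ dY.t.ι = dX.t.ι ≫ f
  h : dX.s.high ⟶ dY.s.high
  hh : dX.s.π ≫ h = g ≫ dY.s.π

/-- A truncation triangle at level `n`, with respect to the left aisle `U`, inside
the subcategory `T_c` of compact objects. -/
structure CTruncTriangle (U : Set T) (n : ℤ) (X : T) where
  low : T
  high : T
  ι : low ⟶ X
  π : X ⟶ high
  δ : high ⟶ low⟦(1 : ℤ)⟧
  low_mem : low⟦n⟧ ∈ U
  high_compact : IsCompactObj T high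
  high_orth : ∀ Z : T, Z⟦n⟧ ∈ U → ∀ f : Z ⟶ high, f = 0
  dist : Triangle.mk ι π δ ∈ (distTriang T)

/-- Data computing the homology `H^n X` with respect to the aisle `U` in `T_c`. -/
structure CHomologyData (U : Set T) (n : ℤ) (X : T) where
  t : CTruncTriangle T U n X
  s : CTruncTriangle T U (n - 1) t.low

/-- The morphism induced by `f` on `U`-homology objects in `T_c`. -/
structure CHomologyMapData (U : Set T) (n : ℤ) {X Y : T} (f : X ⟶ Y)
    (dX : CHomologyData T U n X) (dY : CHomologyData T U n Y) where
  g : dX.t.low ⟶ dY.t.low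
  hg : g ≫ dY.t.ι = dX.t.ι ≫ f
  h : dX.s.high ⟶ dY.s.high
  hh : dX.s.π ≫ h = g ≫ dY.s.π

/-- The left aisle `U ⊆ T_c` is non-degenerate: a morphism `f` of `T_c` is
invertible if and only if `H^p(f)` is invertible for all `p : ℤ`. -/
def UNondegenerate (U : Set T) : Prop :=
  ∀ ⦃X Y : T⦄, IsCompactObj T X → IsCompactObj T Y → ∀ f : X ⟶ Y,
    (IsIso f ↔ ∀ (p : ℤ) (dX : CHomologyData T U p X) (dY : CHomologyData T U p Y)
      (m : CHomologyMapData T U p f dX dY), IsIso m.h)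

/-- Condition (†): for each compact `X` there is an integer `N` such that
`Hom(X, S^N U') = 0` for every `U' ∈ U`. -/
def CondDagger (U : Set T) : Prop :=
  ∀ X : T, IsCompactObj T X → ∃ N : ℤ, ∀ U' ∈ U, ∀ f : X ⟶ U'⟦N⟧, f = 0

section Helpers

variable {T}

open scoped ZeroObject

set_option linter.unusedSectionVars false

/-- The projection of a coproduct onto a component. -/
noncomputable def spi {I : Type v} (Y : I → T) (i : I) : ∐ Y ⟶ Y i :=
  open Classical in Sigma.π Y i

lemma ι_spi_self {I : Type v} (Y : I → T) (b : I) : Sigma.ι Y b ≫ spi Y b = 𝟙 _ := by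
  classical
  exact Sigma.ι_π_eq_id Y b

lemma ι_spi_ne {I : Type v} (Y : I → T) {b c : I} (h : b ≠ c) :
    Sigma.ι Y b ≫ spi Y c = 0 := by
  classical
  exact Sigma.ι_π_of_ne Y h

/-- The projection of a coproduct onto a sub-coproduct indexed by a finite set. -/
noncomputable def fproj {I : Type v} (Y : I → T) (s : Finset I) : ∐ Y ⟶ ∐ Y :=
  open Classical in Sigma.desc fun i => if i ∈ s then Sigma.ι Y i else 0

lemma ι_fproj_mem {I : Type v} (Y : I → T) (s : Finset I) {i : I} (h : i ∈ s) :
    Sigma.ι Y i ≫ fproj Y s = Sigma.ι Y i := by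
  simp [fproj, h]

lemma ι_fproj_not_mem {I : Type v} (Y : I → T) (s : Finset I) {i : I} (h : i ∉ s) :
    Sigma.ι Y i ≫ fproj Y s = 0 := by
  simp [fproj, h]

lemma fproj_comp_of_subset {I : Type v} (Y : I → T) {s t : Finset I} (h : s ⊆ t) :
    fproj Y s ≫ fproj Y t = fproj Y s := by
  refine Sigma.hom_ext _ _ fun i => ?_
  by_cases hi : i ∈ s
  · rw [← Category.assoc, ι_fproj_mem Y s hi, ι_fproj_mem Y t (h hi)]
  · rw [← Category.assoc, ι_fproj_not_mem Y s hi, zero_comp]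

lemma fproj_eq_sum {I : Type v} (Y : I → T) (s : Finset I) :
    fproj Y s = ∑ i ∈ s, spi Y i ≫ Sigma.ι Y i := by
  refine Sigma.hom_ext _ _ fun i => ?_
  rw [Preadditive.comp_sum]
  by_cases hi : i ∈ s
  · rw [ι_fproj_mem Y s hi, Finset.sum_eq_single i]
    · rw [← Category.assoc, ι_spi_self, Category.id_comp]
    · intro j _ hj
      rw [← Category.assoc, ι_spi_ne _ hj.symm, zero_comp]
    · exact fun h => absurd hi h
  · rw [ι_fproj_not_mem Y s hi, Finset.sum_eq_zero]
    intro j hj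
    rw [← Category.assoc, ι_spi_ne _ (b := i) (c := j) (fun h => hi (h ▸ hj)), zero_comp]

/-- Elementary form of compactness. -/
def PC (C : T) : Prop :=
  ∀ (I : Type v) (Y : I → T) (f : C ⟶ ∐ Y), ∃ s : Finset I, f ≫ fproj Y s = f

lemma fproj_mono {I : Type v} {Y : I → T} {C : T} {f : C ⟶ ∐ Y} {s t : Finset I}
    (hf : f ≫ fproj Y s = f) (h : s ⊆ t) : f ≫ fproj Y t = f := by
  rw [← hf, Category.assoc, fproj_comp_of_subset Y h]

lemma PC_of_compact {C : T} (hC : IsCompactObj T C) : PC C := by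
  classical
  intro I Y f
  have := hC I
  let F : T ⥤ AddCommGrpCat.{v} := preadditiveCoyoneda.obj (Opposite.op C)
  let H : AddSubgroup (C ⟶ ∐ Y) :=
    { carrier := {f | ∃ s : Finset I, f ≫ fproj Y s = f}
      zero_mem' := ⟨∅, by simp⟩
      add_mem' := by
        rintro a b ⟨s, hs⟩ ⟨t, ht⟩
        refine ⟨s ∪ t, ?_⟩
        rw [Preadditive.add_comp, fproj_mono hs Finset.subset_union_left,
          fproj_mono ht Finset.subset_union_right]
      neg_mem' := by
        rintro a ⟨s, hs⟩
        exact ⟨s, by rw [Preadditive.neg_comp, hs]⟩ }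
  have hc : IsColimit (F.mapCocone (colimit.cocone (Discrete.functor Y))) :=
    isColimitOfPreserves F (colimit.isColimit _)
  let m : F.obj (∐ Y) ⟶ AddCommGrpCat.of ((C ⟶ ∐ Y) ⧸ H) :=
    AddCommGrpCat.ofHom (QuotientAddGroup.mk' H)
  have hm : m = 0 := by
    refine hc.hom_ext fun ⟨i⟩ => ?_
    ext g
    exact (QuotientAddGroup.eq_zero_iff _).2
      ⟨{i}, by
        change (g ≫ Sigma.ι Y i) ≫ fproj Y {i} = g ≫ Sigma.ι Y i
        have e := ι_fproj_mem Y {i} (Finset.mem_singleton_self i)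
        have e2 : ∀ g : C ⟶ Y i, (g ≫ Sigma.ι Y i) ≫ fproj Y {i} = g ≫ Sigma.ι Y i := fun g => by
          rw [Category.assoc, e]
        exact e2 g⟩
  have h2 : (QuotientAddGroup.mk' H) f = 0 := by
    have := congrArg (fun k => k.hom f) hm
    exact this
  exact (QuotientAddGroup.eq_zero_iff f).1 h2

lemma PC_iso {C D : T} (e : C ≅ D) (h : PC C) : PC D := by
  intro I Y f
  obtain ⟨s, hs⟩ := h I Y (e.hom ≫ f)
  refine ⟨s, ?_⟩
  rw [Category.assoc] at hs
  exact (cancel_epi e.hom).1 hs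

lemma PC_zero {C : T} (h : IsZero C) : PC C := fun _ _ _ => ⟨∅, h.eq_of_src _ _⟩

lemma PC_shift {C : T} (h : PC C) (n : ℤ) : PC (C⟦n⟧) := by
  intro I Y f
  let F := shiftFunctor T (-n)
  let k := sigmaComparison F Y
  obtain ⟨s, hs⟩ := h I (fun i => F.obj (Y i)) ((shiftShiftNeg C n).inv ≫ F.map f ≫ inv k)
  refine ⟨s, F.map_injective ?_⟩
  have hk : fproj (fun i => F.obj (Y i)) s ≫ k = k ≫ F.map (fproj Y s) := by
    refine Sigma.hom_ext _ _ fun i => ?_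
    simp only [k]
    rw [ι_comp_sigmaComparison_assoc, ← F.map_comp]
    by_cases hi : i ∈ s
    · rw [ι_fproj_mem Y s hi, ← Category.assoc, ι_fproj_mem _ s hi, ι_comp_sigmaComparison]
    · rw [ι_fproj_not_mem Y s hi, ← Category.assoc, ι_fproj_not_mem _ s hi, zero_comp,
        F.map_zero]
  have h3 := congrArg (fun z => z ≫ k) hs
  simp only [Category.assoc, hk, IsIso.inv_hom_id, IsIso.inv_hom_id_assoc, Category.comp_id] at h3
  rw [F.map_comp]
  exact (cancel_epi (shiftShiftNeg C n).inv).1 h3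

lemma PC_ext (Tr : Triangle T) (hTr : Tr ∈ distTriang T) (h₁ : PC Tr.obj₁) (h₃ : PC Tr.obj₃) :
    PC Tr.obj₂ := by
  classical
  intro I Y f
  obtain ⟨s, hs⟩ := h₁ I Y (Tr.mor₁ ≫ f)
  obtain ⟨g, hg⟩ := Triangle.yoneda_exact₂ Tr hTr (f - f ≫ fproj Y s) (by
    rw [Preadditive.comp_sub, ← Category.assoc, hs, sub_self])
  obtain ⟨t, ht⟩ := h₃ I Y g
  refine ⟨s ∪ t, ?_⟩
  have e1 : (f - f ≫ fproj Y s) ≫ fproj Y (s ∪ t) = f - f ≫ fproj Y s := by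
    rw [hg, Category.assoc, fproj_mono ht Finset.subset_union_right]
  rw [Preadditive.sub_comp, Category.assoc, fproj_comp_of_subset Y Finset.subset_union_left] at e1
  exact sub_left_injective e1

lemma unshift {K Z : T} (a : K ⟶ Z⟦(1 : ℤ)⟧) :
    ∃ (a' : K⟦(-1 : ℤ)⟧ ⟶ Z) (e : K ≅ (K⟦(-1 : ℤ)⟧)⟦(1 : ℤ)⟧), a = e.hom ≫ a'⟦(1 : ℤ)⟧' := by
  refine ⟨(shiftFunctor T (1 : ℤ)).preimage ((shiftNegShift K (1 : ℤ)).hom ≫ a),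
    (shiftNegShift K (1 : ℤ)).symm, ?_⟩
  simp

/-- Extending a map along the first map of a triangle. -/
lemma extend_map (Tr : Triangle T) (hTr : Tr ∈ distTriang T) {X : T} (φ : Tr.obj₁ ⟶ X)
    (h : Tr.mor₃ ≫ φ⟦(1 : ℤ)⟧' = 0) : ∃ ψ : Tr.obj₂ ⟶ X, Tr.mor₁ ≫ ψ = φ := by
  obtain ⟨b, hb, -⟩ := complete_distinguished_triangle_morphism₂ Tr _ hTr
    (contractible_distinguished X) φ 0 (by rw [zero_comp]; exact h)
  exact ⟨b, hb.trans (Category.comp_id _)⟩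

lemma aisleGen_shift {U : Set T} (hU : ∀ X ∈ U, X⟦(1 : ℤ)⟧ ∈ U) {X : T} (h : aisleGen T U X) :
    aisleGen T U (X⟦(1 : ℤ)⟧) := by
  induction h with
  | of X hX => exact .of _ (hU X hX)
  | iso X Y e _ ih => exact .iso _ _ ((shiftFunctor T (1 : ℤ)).mapIso e) ih
  | coprod Y _ ih =>
    exact .iso _ _ (PreservesCoproduct.iso (shiftFunctor T (1 : ℤ)) Y).symm (.coprod _ ih)
  | ext Tr hT _ _ ih₁ ih₃ => exact .ext _ (Triangle.shift_distinguished Tr hT 1) ih₁ ih₃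

section Hocolim

variable (Y : ℕ → T) (t : ∀ n, Y n ⟶ Y (n + 1))

/-- The family `Y` indexed by a type in the right universe. -/
abbrev UY : ULift.{v} ℕ → T := fun n => Y n.down

/-- inclusion -/
noncomputable abbrev inj (n : ℕ) : Y n ⟶ ∐ (UY Y) := Sigma.ι (UY Y) ⟨n⟩

/-- identity minus shift -/
noncomputable def oneSub : ∐ (UY Y) ⟶ ∐ (UY Y) :=
  Sigma.desc fun n => inj Y n.down - t n.down ≫ inj Y (n.down + 1)

lemma inj_oneSub (n : ℕ) : inj Y n ≫ oneSub Y t = inj Y n - t n ≫ inj Y (n + 1) := by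
  simp [oneSub, inj]

lemma oneSub_π_zero : oneSub Y t ≫ spi (UY Y) ⟨0⟩ = spi (UY Y) ⟨0⟩ := by
  refine Sigma.hom_ext _ _ fun n => ?_
  have := inj_oneSub Y t n.down
  rw [← Category.assoc]
  erw [this]
  rw [Preadditive.sub_comp, Category.assoc,
    ι_spi_ne (UY Y) (b := ⟨n.down + 1⟩) (c := ⟨0⟩) (by simp), comp_zero, sub_zero]

lemma oneSub_π_succ (m : ℕ) : oneSub Y t ≫ spi (UY Y) ⟨m + 1⟩ =
    spi (UY Y) ⟨m + 1⟩ - spi (UY Y) ⟨m⟩ ≫ t m := by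
  refine Sigma.hom_ext _ _ fun n => ?_
  obtain ⟨n⟩ := n
  have := inj_oneSub Y t n
  rw [← Category.assoc]
  erw [this]
  rw [Preadditive.sub_comp, Preadditive.comp_sub, Category.assoc]
  congr 1
  by_cases h : n = m
  · subst h
    rw [← Category.assoc (Sigma.ι _ _), ι_spi_self, ι_spi_self, Category.comp_id,
      Category.id_comp]
  · rw [← Category.assoc (Sigma.ι _ _),
      ι_spi_ne (UY Y) (b := ⟨n + 1⟩) (c := ⟨m + 1⟩) (by simpa using h),
      ι_spi_ne (UY Y) (b := ⟨n⟩) (c := ⟨m⟩) (by simpa using h), comp_zero, zero_comp]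

lemma eq_zero_of_oneSub {K : T} (hK : PC K) (a : K ⟶ ∐ (UY Y)) (ha : a ≫ oneSub Y t = 0) :
    a = 0 := by
  have hz : ∀ n : ℕ, a ≫ spi (UY Y) ⟨n⟩ = 0 := by
    intro n
    induction n with
    | zero => rw [← oneSub_π_zero Y t, ← Category.assoc, ha, zero_comp]
    | succ m ih =>
      have h := oneSub_π_succ Y t m
      have h2 : a ≫ spi (UY Y) ⟨m + 1⟩ - (a ≫ spi (UY Y) ⟨m⟩) ≫ t m = 0 := by
        rw [Category.assoc, ← Preadditive.comp_sub, ← h, ← Category.assoc, ha, zero_comp]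
      rw [ih, zero_comp, sub_zero] at h2
      exact h2
  obtain ⟨s, hs⟩ := hK _ _ a
  rw [← hs, fproj_eq_sum, Preadditive.comp_sum]
  refine Finset.sum_eq_zero fun n _ => ?_
  rw [← Category.assoc]
  erw [hz n.down]
  rw [zero_comp]

variable {Yi : T} (q : ∐ (UY Y) ⟶ Yi) (d : Yi ⟶ (∐ (UY Y))⟦(1 : ℤ)⟧)

lemma inj_q (hTr : Triangle.mk (oneSub Y t) q d ∈ distTriang T)
    (n : ℕ) : inj Y n ≫ q = t n ≫ inj Y (n + 1) ≫ q := by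
  have h1 : oneSub Y t ≫ q = 0 := comp_distTriang_mor_zero₁₂ _ hTr
  have h2 := inj_oneSub Y t n
  have h3 : (inj Y n - t n ≫ inj Y (n + 1)) ≫ q = 0 := by
    rw [← h2, Category.assoc, h1, comp_zero]
  rw [Preadditive.sub_comp, Category.assoc] at h3
  exact sub_eq_zero.1 h3

lemma push_q (hTr : Triangle.mk (oneSub Y t) q d ∈ distTriang T)
    {K : T} (n k : ℕ) (c : K ⟶ Y n) :
    ∃ c' : K ⟶ Y (n + k), c ≫ inj Y n ≫ q = c' ≫ inj Y (n + k) ≫ q := by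
  induction k with
  | zero => exact ⟨c, rfl⟩
  | succ k ih =>
    obtain ⟨c', hc'⟩ := ih
    refine ⟨c' ≫ t (n + k), ?_⟩
    rw [hc', inj_q Y t q d hTr (n + k), Category.assoc]
    rfl

lemma push_q' (hTr : Triangle.mk (oneSub Y t) q d ∈ distTriang T)
    {K : T} (n N : ℕ) (h : n ≤ N) (c : K ⟶ Y n) :
    ∃ c' : K ⟶ Y N, c ≫ inj Y n ≫ q = c' ≫ inj Y N ≫ q := by
  obtain ⟨k, rfl⟩ := Nat.exists_eq_add_of_le h
  exact push_q Y t q d hTr n k c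

lemma factor_hocolim (hTr : Triangle.mk (oneSub Y t) q d ∈ distTriang T)
    {K : T} (hK : PC K) (h : K ⟶ Yi) :
    ∃ (N : ℕ) (c : K ⟶ Y N), h = c ≫ inj Y N ≫ q := by
  have h0 : h ≫ d = 0 := by
    obtain ⟨a, e, ha⟩ := unshift (h ≫ d)
    have h31 : d ≫ (oneSub Y t)⟦(1 : ℤ)⟧' = 0 := comp_distTriang_mor_zero₃₁ _ hTr
    have : a = 0 := by
      refine eq_zero_of_oneSub Y t (PC_shift hK _) a ?_
      apply (shiftFunctor T (1 : ℤ)).map_injective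
      rw [Functor.map_comp, Functor.map_zero, ← cancel_epi e.hom, ← Category.assoc, ← ha,
        Category.assoc, h31, comp_zero, comp_zero]
    rw [ha, this, Functor.map_zero, comp_zero]
  obtain ⟨b, hb⟩ := Triangle.coyoneda_exact₃ _ hTr h h0
  change K ⟶ ∐ (UY Y) at b
  change h = b ≫ q at hb
  obtain ⟨s, hs⟩ := hK _ _ b
  have key : ∀ s : Finset (ULift.{v} ℕ), ∃ (N : ℕ) (c : K ⟶ Y N),
      b ≫ fproj (UY Y) s ≫ q = c ≫ inj Y N ≫ q := by
    classical
    intro s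
    induction s using Finset.induction_on with
    | empty => exact ⟨0, 0, by rw [fproj_eq_sum]; simp⟩
    | insert i s hi ih =>
      obtain ⟨N, c, hc⟩ := ih
      obtain ⟨c', hc'⟩ := push_q' Y t q d hTr N (max N i.down) (le_max_left _ _) c
      obtain ⟨c'', hc''⟩ := push_q' Y t q d hTr i.down (max N i.down) (le_max_right _ _)
        (b ≫ spi (UY Y) i)
      refine ⟨max N i.down, c'' + c', ?_⟩
      rw [Preadditive.add_comp, ← hc', ← hc'', ← hc, fproj_eq_sum, fproj_eq_sum,
        Finset.sum_insert hi, Preadditive.add_comp, Preadditive.comp_add]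
      simp only [Category.assoc]
  obtain ⟨N, c, hc⟩ := key s
  refine ⟨N, c, ?_⟩
  rw [← hc, ← Category.assoc, hs, hb]

end Hocolim

/-- One step of the small object argument. -/
lemma step {U : Set T} {J : Type v} (s : J → T) (hs : ∀ j, s j ∈ U) {X : T}
    (Y : T) (hY : aisleGen T U Y) (φ : Y ⟶ X) :
    ∃ (Y' : T) (t : Y ⟶ Y') (φ' : Y' ⟶ X), aisleGen T U Y' ∧ t ≫ φ' = φ ∧
      ∀ (j : J) (u : s j ⟶ Y⟦(1 : ℤ)⟧), u ≫ φ⟦(1 : ℤ)⟧' = 0 → u ≫ t⟦(1 : ℤ)⟧' = 0 := by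
  let I : Type v := Σ j : J, {u : s j ⟶ Y⟦(1 : ℤ)⟧ // u ≫ φ⟦(1 : ℤ)⟧' = 0}
  let Z : I → T := fun i => s i.1
  let w : ∐ Z ⟶ Y⟦(1 : ℤ)⟧ := Sigma.desc fun i => i.2.1
  obtain ⟨Y', t, p, hTr⟩ := distinguished_cocone_triangle₂ w
  have hw : w ≫ φ⟦(1 : ℤ)⟧' = 0 := by
    refine Sigma.hom_ext _ _ fun i => ?_
    simp only [w, colimit.ι_desc_assoc, Cofan.mk_ι_app, comp_zero]
    exact i.2.2
  obtain ⟨φ', hφ'⟩ := extend_map _ hTr φ hw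
  refine ⟨Y', t, φ', ?_, hφ', ?_⟩
  · exact .ext _ hTr hY (.coprod Z fun i => .of _ (hs i.1))
  · intro j u hu
    have h31 : w ≫ t⟦(1 : ℤ)⟧' = 0 := comp_distTriang_mor_zero₃₁ _ hTr
    have : u = Sigma.ι Z ⟨j, u, hu⟩ ≫ w := by simp [w]
    rw [this, Category.assoc, h31, comp_zero]

/-- Small object argument. -/
theorem small_object {U : Set T} (hU : ∀ X ∈ U, X⟦(1 : ℤ)⟧ ∈ U) {J : Type v} (s : J → T)
    (hs : ∀ j, s j ∈ U) (hc : ∀ j, PC (s j)) (X : T) :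
    ∃ (X'' X' : T) (f : X'' ⟶ X) (g : X ⟶ X') (h : X' ⟶ X''⟦(1 : ℤ)⟧),
      Triangle.mk f g h ∈ (distTriang T) ∧ aisleGen T U X'' ∧
      ∀ j, ∀ u : s j ⟶ X', u = 0 := by
  let St : Type (max u v) := {p : Σ Y : T, (Y ⟶ X) // aisleGen T U p.1}
  have hstep : ∀ p : St, ∃ (p' : St) (t : p.1.1 ⟶ p'.1.1), t ≫ p'.1.2 = p.1.2 ∧
      ∀ (j : J) (u : s j ⟶ p.1.1⟦(1 : ℤ)⟧), u ≫ p.1.2⟦(1 : ℤ)⟧' = 0 → u ≫ t⟦(1 : ℤ)⟧' = 0 := by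
    rintro ⟨⟨Y, φ⟩, hY⟩
    obtain ⟨Y', t, φ', h1, h2, h3⟩ := step s hs Y hY φ
    exact ⟨⟨⟨Y', φ'⟩, h1⟩, t, h2, h3⟩
  choose nxt tr htr1 htr2 using hstep
  let I : Type v := Σ j : J, (s j ⟶ X)
  let Z : I → T := fun i => s i.1
  let p0 : St := ⟨⟨∐ Z, Sigma.desc fun i => i.2⟩, .coprod Z fun i => .of _ (hs i.1)⟩
  let p : ℕ → St := fun n => Nat.rec p0 (fun _ q => nxt q) n
  let Y : ℕ → T := fun n => (p n).1.1
  let φ : ∀ n, Y n ⟶ X := fun n => (p n).1.2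
  let t : ∀ n, Y n ⟶ Y (n + 1) := fun n => tr (p n)
  have ht1 : ∀ n, t n ≫ φ (n + 1) = φ n := fun n => htr1 (p n)
  have ht2 : ∀ n (j : J) (u : s j ⟶ (Y n)⟦(1 : ℤ)⟧), u ≫ (φ n)⟦(1 : ℤ)⟧' = 0 →
    u ≫ (t n)⟦(1 : ℤ)⟧' = 0 := fun n => htr2 (p n)
  have hY : ∀ n, aisleGen T U (Y n) := fun n => (p n).2
  have h0 : ∀ j (u : s j ⟶ X), ∃ a : s j ⟶ Y 0, a ≫ φ 0 = u := by
    intro j u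
    refine ⟨Sigma.ι Z ⟨j, u⟩, ?_⟩
    change Sigma.ι Z ⟨j, u⟩ ≫ (Sigma.desc fun i => i.2) = u
    simp
  obtain ⟨Yi, q, d, hTr⟩ := distinguished_cocone_triangle (oneSub Y t)
  have hYi : aisleGen T U Yi := by
    have hC : aisleGen T U (∐ (UY Y)) := .coprod _ fun n => hY n.down
    exact .ext _ (rot_of_distTriang _ hTr) hC (aisleGen_shift hU hC)
  let Φ : ∐ (UY Y) ⟶ X := Sigma.desc fun n => φ n.down
  have hιΦ : ∀ n, inj Y n ≫ Φ = φ n := fun n => by simp [Φ, inj]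
  have hΦ : oneSub Y t ≫ Φ = 0 := by
    refine Sigma.hom_ext _ _ fun n => ?_
    obtain ⟨n⟩ := n
    have := inj_oneSub Y t n
    rw [← Category.assoc]
    erw [this]
    rw [Preadditive.sub_comp, Category.assoc, hιΦ, hιΦ, ht1, sub_self, comp_zero]
  obtain ⟨f, hf⟩ := Triangle.yoneda_exact₂ _ hTr Φ hΦ
  change Yi ⟶ X at f
  change Φ = q ≫ f at hf
  have hqf : ∀ n, inj Y n ≫ q ≫ f = φ n := fun n => by rw [← hf, hιΦ]
  obtain ⟨X', g, h, hTr'⟩ := distinguished_cocone_triangle f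
  refine ⟨Yi, X', f, g, h, hTr', hYi, ?_⟩
  intro j u
  have hh : h ≫ f⟦(1 : ℤ)⟧' = 0 := comp_distTriang_mor_zero₃₁ _ hTr'
  have hfg : f ≫ g = 0 := comp_distTriang_mor_zero₁₂ _ hTr'
  have huh : u ≫ h = 0 := by
    obtain ⟨a, e, ha⟩ := unshift (u ≫ h)
    obtain ⟨N, c, hcN⟩ := factor_hocolim Y t q d hTr (PC_shift (hc j) (-1)) a
    have h1 : (e.hom ≫ c⟦(1 : ℤ)⟧') ≫ (φ N)⟦(1 : ℤ)⟧' = 0 := by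
      have h3 : c ≫ φ N = a ≫ f := by
        rw [hcN, ← hqf]
        simp only [Category.assoc]
      rw [Category.assoc, ← Functor.map_comp, h3, Functor.map_comp, ← Category.assoc, ← ha,
        Category.assoc, hh, comp_zero]
    have h2 := ht2 N j _ h1
    rw [ha, hcN, inj_q Y t q d hTr N, Functor.map_comp, Functor.map_comp]
    rw [Category.assoc] at h2
    have h4 := congrArg (fun z => z ≫ (inj Y (N + 1) ≫ q)⟦(1 : ℤ)⟧') h2
    simpa using h4
  obtain ⟨b, hb⟩ := Triangle.coyoneda_exact₃ _ hTr' u huh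
  change s j ⟶ X at b
  change u = b ≫ g at hb
  obtain ⟨a, ha⟩ := h0 j b
  rw [hb, ← ha, ← hqf]
  simp only [Category.assoc, hfg, comp_zero]

/-- Levels of objects finitely built from a family. -/
noncomputable def lvl {J : Type v} (s : J → T) : ℕ → Σ K : Type v, K → T
  | 0 => ⟨Option J, fun o => o.elim 0 s⟩
  | n + 1 =>
    ⟨(lvl s n).1 ⊕ (Σ (a b : (lvl s n).1), ((lvl s n).2 b ⟶ ((lvl s n).2 a)⟦(1 : ℤ)⟧)),
      Sum.elim (lvl s n).2 (fun x => (distinguished_cocone_triangle₂ x.2.2).choose)⟩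

/-- Objects finitely built from a family. -/
def FB {J : Type v} (s : J → T) (X : T) : Prop :=
  ∃ (n : ℕ) (j : (lvl s n).1), Nonempty (X ≅ (lvl s n).2 j)

lemma lvl_mono {J : Type v} (s : J → T) (n m : ℕ) (h : n ≤ m) (j : (lvl s n).1) :
    ∃ j' : (lvl s m).1, (lvl s m).2 j' = (lvl s n).2 j := by
  induction h with
  | refl => exact ⟨j, rfl⟩
  | step _ ih =>
    obtain ⟨j', hj'⟩ := ih
    exact ⟨Sum.inl j', hj'⟩

lemma FB_of {J : Type v} (s : J → T) (j : J) : FB s (s j) := ⟨0, some j, ⟨Iso.refl _⟩⟩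

lemma FB_zero {J : Type v} (s : J → T) : FB s (0 : T) := ⟨0, none, ⟨Iso.refl _⟩⟩

lemma FB_ext {J : Type v} (s : J → T) (Tr : Triangle T) (hTr : Tr ∈ distTriang T)
    (h₁ : FB s Tr.obj₁) (h₃ : FB s Tr.obj₃) : FB s Tr.obj₂ := by
  obtain ⟨n, a, ⟨ea⟩⟩ := h₁
  obtain ⟨m, b, ⟨eb⟩⟩ := h₃
  obtain ⟨a', ha'⟩ := lvl_mono s n (max n m) (le_max_left _ _) a
  obtain ⟨b', hb'⟩ := lvl_mono s m (max n m) (le_max_right _ _) b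
  rw [← ha'] at ea
  rw [← hb'] at eb
  let w := eb.inv ≫ Tr.mor₃ ≫ ea.hom⟦(1 : ℤ)⟧'
  refine ⟨max n m + 1, Sum.inr ⟨a', b', w⟩, ?_⟩
  change Nonempty (Tr.obj₂ ≅ (distinguished_cocone_triangle₂ w).choose)
  obtain ⟨f, g, hD⟩ := (distinguished_cocone_triangle₂ w).choose_spec
  have comm : Tr.mor₃ ≫ ea.hom⟦(1 : ℤ)⟧' = eb.hom ≫ w := by simp [w]
  obtain ⟨c, hc1, hc2⟩ := complete_distinguished_triangle_morphism₂ Tr _ hTr hD ea.hom eb.hom comm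
  let ψ : Tr ⟶ Triangle.mk f g w :=
    { hom₁ := ea.hom, hom₂ := c, hom₃ := eb.hom, comm₁ := hc1, comm₂ := hc2, comm₃ := comm }
  have hc : IsIso ψ.hom₂ := isIso₂_of_isIso₁₃ ψ hTr hD
    (inferInstanceAs (IsIso ea.hom)) (inferInstanceAs (IsIso eb.hom))
  exact ⟨@asIso _ _ _ _ c hc⟩

lemma FB_PC {J : Type v} (s : J → T) (hs : ∀ j, PC (s j)) {X : T} (h : FB s X) : PC X := by
  obtain ⟨n, j, ⟨e⟩⟩ := h
  refine PC_iso e.symm ?_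
  clear e
  induction n with
  | zero =>
    cases j with
    | none => exact PC_zero (isZero_zero T)
    | some j => exact hs j
  | succ n ih =>
    rcases j with j | ⟨a, b, w⟩
    · exact ih j
    · obtain ⟨f, g, hD⟩ := (distinguished_cocone_triangle₂ w).choose_spec
      exact PC_ext _ hD (ih a) (ih b)

/-- Maps from compact objects to `Y` factor through finitely built objects. -/
def QF {J : Type v} (s : J → T) (Y : T) : Prop :=
  ∀ (K : T) (_ : PC K) (f : K ⟶ Y), ∃ (E : T) (_ : FB s E) (a : K ⟶ E) (b : E ⟶ Y), f = a ≫ b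

lemma factor_add {J : Type v} (s : J → T) {K Y : T} {f g : K ⟶ Y}
    (hf : ∃ (E : T) (_ : FB s E) (a : K ⟶ E) (b : E ⟶ Y), f = a ≫ b)
    (hg : ∃ (E : T) (_ : FB s E) (a : K ⟶ E) (b : E ⟶ Y), g = a ≫ b) :
    ∃ (E : T) (_ : FB s E) (a : K ⟶ E) (b : E ⟶ Y), f + g = a ≫ b := by
  obtain ⟨E, hE, a, b, rfl⟩ := hf
  obtain ⟨E', hE', a', b', rfl⟩ := hg
  exact ⟨E ⊞ E', FB_ext s _ (binaryBiproductTriangle_distinguished E E') hE hE',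
    biprod.lift a a', biprod.desc b b', by simp⟩

lemma QF_coprod {J : Type v} (s : J → T) {I : Type v} (Y : I → T) (hY : ∀ i, QF s (Y i)) :
    QF s (∐ Y) := by
  classical
  intro K hK f
  obtain ⟨S, hS⟩ := hK I Y f
  rw [← hS, fproj_eq_sum, Preadditive.comp_sum]
  clear hS
  induction S using Finset.induction_on with
  | empty => exact ⟨0, FB_zero s, 0, 0, by simp⟩
  | insert i S hi ih =>
    rw [Finset.sum_insert hi]
    refine factor_add s ?_ ih
    obtain ⟨E, hE, a, b, hab⟩ := hY i K hK (f ≫ spi Y i)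
    exact ⟨E, hE, a, b ≫ Sigma.ι Y i, by rw [← Category.assoc, hab, Category.assoc]⟩

lemma QF_ext {J : Type v} (s : J → T) (hs : ∀ j, PC (s j))
    (Tr : Triangle T) (hTr : Tr ∈ distTriang T)
    (h₁ : QF s Tr.obj₁) (h₃ : QF s Tr.obj₃) : QF s Tr.obj₂ := by
  intro C hC f
  obtain ⟨F, hF, x, y, hxy⟩ := h₃ C hC (f ≫ Tr.mor₂)
  obtain ⟨z, e, hz⟩ := unshift (y ≫ Tr.mor₃)
  obtain ⟨W, hW, z₁, z₂, rfl⟩ := h₁ _ (PC_shift (FB_PC s hs hF) (-1)) z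
  -- the map `F ⟶ W⟦1⟧`
  let w : F ⟶ W⟦(1 : ℤ)⟧ := e.hom ≫ z₁⟦(1 : ℤ)⟧'
  have hw : w ≫ z₂⟦(1 : ℤ)⟧' = y ≫ Tr.mor₃ := by
    rw [hz, Functor.map_comp, Category.assoc]
  obtain ⟨D, d₁, d₂, hD⟩ := distinguished_cocone_triangle₂ (x ≫ w)
  have hDC : PC D := PC_ext _ hD (FB_PC s hs hW) hC
  have h23 : Tr.mor₂ ≫ Tr.mor₃ = 0 := comp_distTriang_mor_zero₂₃ _ hTr
  obtain ⟨k, hk⟩ := extend_map _ hD z₂ (by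
    change (x ≫ w) ≫ z₂⟦(1 : ℤ)⟧' = 0
    rw [Category.assoc, hw, ← Category.assoc, ← hxy, Category.assoc, h23, comp_zero])
  change D ⟶ Tr.obj₁ at k
  change d₁ ≫ k = z₂ at hk
  obtain ⟨W', hW', k₁, k₂, rfl⟩ := h₁ D hDC k
  let w' : F ⟶ W'⟦(1 : ℤ)⟧ := w ≫ (d₁ ≫ k₁)⟦(1 : ℤ)⟧'
  have hxw' : x ≫ w' = 0 := by
    have h31 : (x ≫ w) ≫ d₁⟦(1 : ℤ)⟧' = 0 := comp_distTriang_mor_zero₃₁ _ hD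
    have := congrArg (fun m => m ≫ k₁⟦(1 : ℤ)⟧') h31
    simpa [w'] using this
  have hw' : w' ≫ k₂⟦(1 : ℤ)⟧' = y ≫ Tr.mor₃ := by
    rw [← hw, ← hk]
    simp only [w', Functor.map_comp, Category.assoc]
  obtain ⟨Z, i, p, hZ⟩ := distinguished_cocone_triangle₂ w'
  have hZF : FB s Z := FB_ext s _ hZ hW' hF
  obtain ⟨b, -, hb2⟩ := complete_distinguished_triangle_morphism₂ _ Tr hZ hTr k₂ y hw'
  change Z ⟶ Tr.obj₂ at b
  change p ≫ y = b ≫ Tr.mor₂ at hb2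
  obtain ⟨l, hl⟩ := Triangle.coyoneda_exact₃ _ hZ x hxw'
  change C ⟶ Z at l
  change x = l ≫ p at hl
  obtain ⟨r, hr⟩ := Triangle.coyoneda_exact₂ _ hTr (f - l ≫ b) (by
    rw [Preadditive.sub_comp, Category.assoc, ← hb2, ← Category.assoc, ← hl, hxy, sub_self])
  have : f = l ≫ b + r ≫ Tr.mor₁ := by rw [← hr]; abel
  rw [this]
  refine factor_add s ⟨Z, hZF, l, b, rfl⟩ ?_
  obtain ⟨E, hE, m, n, rfl⟩ := h₁ C hC r
  exact ⟨E, hE, m, n ≫ Tr.mor₁, by rw [Category.assoc]⟩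

lemma QF_of_aisleGen {J : Type v} (s : J → T) (hs : ∀ j, PC (s j)) {X : T}
    (h : aisleGen T (Set.range s) X) : QF s X := by
  induction h with
  | of X hX =>
    obtain ⟨j, rfl⟩ := hX
    exact fun K _ f => ⟨s j, FB_of s j, f, 𝟙 _, by simp⟩
  | iso X Y e _ ih =>
    intro K hK f
    obtain ⟨E, hE, a, b, hab⟩ := ih K hK (f ≫ e.inv)
    exact ⟨E, hE, a, b ≫ e.hom, by rw [← Category.assoc, ← hab]; simp⟩
  | coprod Y _ ih => exact QF_coprod s Y ih
  | ext Tr hT _ _ ih₁ ih₃ => exact QF_ext s hs Tr hT ih₁ ih₃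

/-- Compact objects are retracts of a small family of objects. -/
lemma exists_retract (hT : CompactlyGenerated T) :
    ∃ (J : Type v) (E : J → T), ∀ C : T, PC C → ∃ (j : J) (a : C ⟶ E j) (b : E j ⟶ C),
      a ≫ b = 𝟙 C := by
  obtain ⟨G, hG, hGc, hGz⟩ := hT
  -- the family of all shifts, closed under suspension up to isomorphism only
  let J : Type v := Shrink.{v} G × ℤ
  let s : J → T := fun j => (((equivShrink G).symm j.1 : G) : T)⟦j.2⟧
  have hs : ∀ j, PC (s j) := fun j => PC_shift (PC_of_compact (hGc _ (Subtype.mem _))) _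
  let U : Set T := {X | ∃ j, Nonempty (X ≅ s j)}
  have hU : ∀ X ∈ U, X⟦(1 : ℤ)⟧ ∈ U := by
    rintro X ⟨j, ⟨e⟩⟩
    exact ⟨(j.1, j.2 + 1), ⟨(shiftFunctor T (1 : ℤ)).mapIso e ≪≫
      ((shiftFunctorAdd T j.2 1).app _).symm⟩⟩
  have hUs : ∀ X, aisleGen T U X → aisleGen T (Set.range s) X := by
    intro X h
    induction h with
    | of X hX =>
      obtain ⟨j, ⟨e⟩⟩ := hX
      exact .iso _ _ e.symm (.of _ ⟨j, rfl⟩)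
    | iso X Y e _ ih => exact .iso _ _ e ih
    | coprod Y _ ih => exact .coprod Y ih
    | ext Tr hT _ _ ih₁ ih₃ => exact .ext Tr hT ih₁ ih₃
  refine ⟨Σ n : ℕ, (lvl s n).1, fun x => (lvl s x.1).2 x.2, fun C hC => ?_⟩
  obtain ⟨X'', X', f, g, h, hTr, hX'', hX'⟩ :=
    small_object hU s (fun j => ⟨j, ⟨Iso.refl _⟩⟩) hs C
  have hz : IsZero X' := by
    refine hGz X' fun D hD n u => ?_
    have e : s (equivShrink G ⟨D, hD⟩, n) = D⟦n⟧ := by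
      simp only [s, Equiv.symm_apply_apply]
    rw [← cancel_epi (eqToHom e), comp_zero]
    exact hX' _ _
  have hf : IsIso f := (Triangle.isZero₃_iff_isIso₁ _ hTr).1 hz
  have hQ : QF s C := QF_of_aisleGen s hs (.iso _ _ (asIso f) (hUs _ hX''))
  obtain ⟨E, ⟨n, j, ⟨e⟩⟩, a, b, hab⟩ := hQ C hC (𝟙 C)
  exact ⟨⟨n, j⟩, a ≫ e.hom, e.inv ≫ b, by simp [← hab]⟩

/-- Any class of compact objects has a small skeleton. -/
lemma exists_skeleton (hT : CompactlyGenerated T) (U : Set T) (hU : ∀ X ∈ U, PC X) :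
    ∃ (J : Type v) (s : J → T), (∀ j, s j ∈ U) ∧ ∀ X ∈ U, ∃ j, Nonempty (X ≅ s j) := by
  obtain ⟨J, E, hE⟩ := exists_retract hT
  let P : (Σ j : J, (E j ⟶ E j)) → T → Prop := fun x C =>
    C ∈ U ∧ ∃ (a : C ⟶ E x.1) (b : E x.1 ⟶ C), a ≫ b = 𝟙 C ∧ b ≫ a = x.2
  refine ⟨{x : Σ j : J, (E j ⟶ E j) // ∃ C, P x C}, fun x => x.2.choose,
    fun x => x.2.choose_spec.1, fun C hC => ?_⟩
  obtain ⟨j, a, b, hab⟩ := hE C (hU C hC)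
  have hx : ∃ C, P ⟨j, b ≫ a⟩ C := ⟨C, hC, a, b, hab, rfl⟩
  refine ⟨⟨⟨j, b ≫ a⟩, hx⟩, ?_⟩
  obtain ⟨-, a', b', hab', hba'⟩ := hx.choose_spec
  change b' ≫ a' = b ≫ a at hba'
  refine ⟨⟨a ≫ b', a' ≫ b, ?_, ?_⟩⟩
  · calc (a ≫ b') ≫ a' ≫ b = a ≫ (b' ≫ a') ≫ b := by simp only [Category.assoc]
      _ = (a ≫ b) ≫ (a ≫ b) := by rw [hba']; simp only [Category.assoc]
      _ = 𝟙 C := by rw [hab, Category.comp_id]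
  · calc (a' ≫ b) ≫ a ≫ b' = a' ≫ (b ≫ a) ≫ b' := by simp only [Category.assoc]
      _ = a' ≫ (b' ≫ a') ≫ b' := congrArg (fun z => a' ≫ z ≫ b') hba'.symm
      _ = (a' ≫ b') ≫ (a' ≫ b') := by simp only [Category.assoc]
      _ = 𝟙 _ := by rw [hab', Category.comp_id]

end Helpers

/-- Truncation-triangle form of Proposition A.1(a): every object `X` of `T` sits in
a distinguished triangle `X'' → X → X' → S X''` with `X'' ∈ T_{≤0}` and
`Hom(R, X') = 0` for every `R ∈ T_{≤0}`. -/
theorem stmt1 (hT : CompactlyGenerated T) (U : LeftAisle T (Compacts T)) (X : T) :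
    ∃ (X'' X' : T) (f : X'' ⟶ X) (g : X ⟶ X') (h : X' ⟶ X''⟦(1 : ℤ)⟧),
      Triangle.mk f g h ∈ (distTriang T) ∧ X'' ∈ TLe0 T U.carrier ∧
      ∀ R ∈ TLe0 T U.carrier, ∀ u : R ⟶ X', u = 0 := by
  obtain ⟨J, s, hs, hs'⟩ := exists_skeleton hT U.carrier
    (fun X hX => PC_of_compact (U.subset hX))
  obtain ⟨X'', X', f, g, h, hTr, hX'', hX'⟩ := small_object U.shift_mem s hs
    (fun j => PC_of_compact (U.subset (hs j))) X
  refine ⟨X'', X', f, g, h, hTr, hX'', ?_⟩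
  intro R hR
  change aisleGen T U.carrier R at hR
  induction hR with
  | of R hR =>
    intro u
    obtain ⟨j, ⟨e⟩⟩ := hs' R hR
    rw [← cancel_epi e.inv, comp_zero]
    exact hX' j _
  | iso R R' e _ ih =>
    intro u
    rw [← cancel_epi e.hom, comp_zero]
    exact ih _
  | coprod Y _ ih =>
    intro u
    refine Sigma.hom_ext _ _ fun i => ?_
    rw [comp_zero]
    exact ih i _
  | ext Tr hD _ _ ih₁ ih₃ =>
    intro u
    obtain ⟨v, rfl⟩ := Triangle.yoneda_exact₂ Tr hD u (ih₁ _)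
    rw [ih₃ v, comp_zero]

end CYPaper
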